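/- For every list of columns s : List (Fin n) and every column i : Fin n, letting d_s := (Finset.univ.image key_s).card and d_{s++[i]} := (Finset.univ.image key_{s++[i]}).card denote the numbers of distinct keys, one has d_{s++[i]} = d_s + ∑_{r=0}^{d_s − 1} newCount_{rk_s,i}(r); that is, each rank-r block of the sorting by s splits into newCount_{rk_s,i}(r) + 1 blocks of the sorting by s++[i]. -/

import Mathlib

open scoped Classical

noncomputable def key {m n : ℕ} (D : Fin m → Fin n → ℝ) (s : List (Fin n)) (j : Fin m) :
    List ℝ := s.map (fun a => D j a)

noncomputable def rk {m n : ℕ} (D : Fin m → Fin n → ℝ) (s : List (Fin n)) (j : Fin m) : ℕ :=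
  ((Finset.univ.image (key D s)).filter (fun v => List.Lex (· < ·) v (key D s j))).card

noncomputable def subID {m n : ℕ} (D : Fin m → Fin n → ℝ) (L : Fin m → ℕ) (i : Fin n)
    (j : Fin m) : ℕ :=
  ((Finset.univ.filter (fun k => L k = L j ∧ D k i < D j i)).image (fun k => D k i)).card

noncomputable def newCount {m n : ℕ} (D : Fin m → Fin n → ℝ) (L : Fin m → ℕ) (i : Fin n)
    (r : ℕ) : ℕ :=
  if (Finset.univ.filter (fun k => L k = r)).Nonempty then
    ((Finset.univ.filter (fun k => L k = r)).image (fun k => D k i)).card - 1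
  else 0

noncomputable def numNewID {m n : ℕ} (D : Fin m → Fin n → ℝ) (L : Fin m → ℕ) (i : Fin n)
    (r : ℕ) : ℕ :=
  ∑ l ∈ Finset.range r, newCount D L i l

noncomputable def Refine {m n : ℕ} (D : Fin m → Fin n → ℝ) (L : Fin m → ℕ) (i : Fin n)
    (j : Fin m) : ℕ :=
  L j + numNewID D L i (L j) + subID D L i j

theorem rk_lt_rk_of_key_lex {m n : ℕ} (D : Fin m → Fin n → ℝ) (s : List (Fin n)) {j k : Fin m}
    (h : List.Lex (· < ·) (key D s j) (key D s k)) : rk D s j < rk D s k := by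
  have h' : key D s j < key D s k := h
  refine Finset.card_lt_card (Finset.ssubset_iff_subset_ne.2 ⟨fun v hv => ?_, fun he => ?_⟩)
  · rw [Finset.mem_filter] at hv ⊢
    have hv' : v < key D s j := hv.2
    exact ⟨hv.1, hv'.trans h'⟩
  · have hmem : key D s j ∈ (Finset.univ.image (key D s)).filter
        (fun v => List.Lex (· < ·) v (key D s k)) := by
      simpa using h
    rw [← he, Finset.mem_filter] at hmem
    exact lt_irrefl (key D s j) hmem.2

theorem rk_eq_rk_iff {m n : ℕ} (D : Fin m → Fin n → ℝ) (s : List (Fin n)) {j k : Fin m} :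
    rk D s j = rk D s k ↔ key D s j = key D s k := by
  refine ⟨fun h => ?_, fun h => by simp only [rk, h]⟩
  rcases lt_trichotomy (key D s j) (key D s k) with hlt | heq | hgt
  · exact absurd h (rk_lt_rk_of_key_lex D s hlt).ne
  · exact heq
  · exact absurd h (rk_lt_rk_of_key_lex D s hgt).ne'

theorem rk_lt_card_keys {m n : ℕ} (D : Fin m → Fin n → ℝ) (s : List (Fin n)) (j : Fin m) :
    rk D s j < (Finset.univ.image (key D s)).card := by
  refine Finset.card_lt_card (Finset.filter_ssubset.2 ⟨key D s j, by simp, fun h => ?_⟩)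
  exact lt_irrefl (key D s j) h

/-- Two functions with the same fibers have equally many values. -/
theorem card_image_eq_of_fibers_eq {ι α β : Type*} [Fintype ι] [DecidableEq α] [DecidableEq β] (f : ι → α) (g : ι → β)
    (h : ∀ j k, f j = f k ↔ g j = g k) :
    (Finset.univ.image f).card = (Finset.univ.image g).card := by
  refine Finset.card_bij (fun a ha => g (Finset.mem_image.1 ha).choose) ?_ ?_ ?_
  · exact fun a ha => Finset.mem_image_of_mem g (Finset.mem_univ _)
  · intro a ha b hb hab
    rw [← (Finset.mem_image.1 ha).choose_spec.2, ← (Finset.mem_image.1 hb).choose_spec.2]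
    exact (h _ _).2 hab
  · intro b hb
    obtain ⟨j, -, rfl⟩ := Finset.mem_image.1 hb
    have hj : f j ∈ Finset.univ.image f := Finset.mem_image_of_mem f (Finset.mem_univ j)
    exact ⟨f j, hj, (h _ _).1 (Finset.mem_image.1 hj).choose_spec.2⟩

theorem image_rk_eq_range {m n : ℕ} (D : Fin m → Fin n → ℝ) (s : List (Fin n)) :
    Finset.univ.image (rk D s) = Finset.range (Finset.univ.image (key D s)).card := by
  refine Finset.eq_of_subset_of_card_le (fun r hr => ?_) ?_
  · obtain ⟨j, -, rfl⟩ := Finset.mem_image.1 hr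
    exact Finset.mem_range.2 (rk_lt_card_keys D s j)
  · rw [Finset.card_range]
    exact (card_image_eq_of_fibers_eq (rk D s) (key D s) fun j k => rk_eq_rk_iff D s).ge

/-- On a nonempty block, `newCount` is one less than the number of distinct values. -/
theorem card_image_block_eq {m n : ℕ} (D : Fin m → Fin n → ℝ) (L : Fin m → ℕ) (i : Fin n)
    {r : ℕ} (hr : r ∈ Finset.univ.image L) :
    ((Finset.univ.filter (fun k => L k = r)).image (fun k => D k i)).card
      = 1 + newCount D L i r := by
  obtain ⟨j, -, hj⟩ := Finset.mem_image.1 hr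
  have hne : (Finset.univ.filter (fun k => L k = r)).Nonempty := ⟨j, by simpa using hj⟩
  have hpos := (hne.image (fun k => D k i)).card_pos
  rw [newCount, if_pos hne]
  omega

theorem card_image_prod_eq_sum {ι α β : Type*} [Fintype ι] [DecidableEq α] [DecidableEq β] (f : ι → α) (g : ι → β) :
    (Finset.univ.image (fun j => (f j, g j))).card
      = ∑ a ∈ Finset.univ.image f, ((Finset.univ.filter (fun k => f k = a)).image g).card := by
  rw [Finset.card_eq_sum_card_fiberwise (f := Prod.fst) (t := Finset.univ.image f)
    (by intro p hp; simp at hp ⊢; obtain ⟨j, rfl⟩ := hp; exact ⟨j, rfl⟩)]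
  refine Finset.sum_congr rfl fun a _ => ?_
  rw [← Finset.card_image_of_injective ((Finset.univ.filter (fun k => f k = a)).image g)
    (Prod.mk_right_injective a)]
  refine congrArg Finset.card ?_
  ext ⟨x, y⟩
  simp only [Finset.mem_filter, Finset.mem_image, Finset.mem_univ, true_and, Prod.mk.injEq]
  grind

theorem key_append_singleton_eq_iff {m n : ℕ} (D : Fin m → Fin n → ℝ) (s : List (Fin n))
    (i : Fin n) (j k : Fin m) :
    key D (s ++ [i]) j = key D (s ++ [i]) k ↔ (rk D s j, D j i) = (rk D s k, D k i) := by
  rw [Prod.mk.injEq, rk_eq_rk_iff]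
  simp [key]

theorem card_distinct_keys_append {m n : ℕ} (hm : 1 ≤ m)
    (D : Fin m → Fin n → ℝ) (s : List (Fin n)) (i : Fin n) :
    (Finset.univ.image (key D (s ++ [i]))).card
      = (Finset.univ.image (key D s)).card
        + ∑ r ∈ Finset.range (Finset.univ.image (key D s)).card,
            newCount D (rk D s) i r := by
  rw [card_image_eq_of_fibers_eq _ _ (key_append_singleton_eq_iff D s i),
    card_image_prod_eq_sum (rk D s) (fun j => D j i),
    Finset.sum_congr rfl fun r hr => card_image_block_eq D (rk D s) i hr,
    Finset.sum_add_distrib, image_rk_eq_range]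
  simp
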